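/- arXiv:2604.11326 — 8 statements merged into one kernel-verified Lean document; each statement's English description precedes it below -/
import Mathlib

section
/- Let H be an edge-colored graph such that for every edge e = vw of H, deleting e decreases the color degree of at least one of its endpoints, i.e., d^c_{H−e}(v) < d^c_H(v) or d^c_{H−e}(w) < d^c_H(w). Then every monochromatic component of H is a star. -/
/-- The color degree of a vertex `v`: the number of distinct colors appearing
on edges of `G` incident to `v`. -/
noncomputable def colorDegree {V C : Type*} (G : SimpleGraph V) (c : Sym2 V → C) (v : V) : ℕ :=
  {col : C | ∃ u, G.Adj v u ∧ c s(v, u) = col}.ncard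

/-- The monochromatic subgraph of `G` formed by all edges of color `col`. -/
def monoGraph {V C : Type*} (G : SimpleGraph V) (c : Sym2 V → C) (col : C) : SimpleGraph V :=
  SimpleGraph.fromEdgeSet {e ∈ G.edgeSet | c e = col}

/-- Deleting an edge `vw` does not lower the color degree of `v` if `v` is incident to another
edge of the same color. -/
theorem colorDegree_le_deleteEdges {V C : Type*} [Finite V] (H : SimpleGraph V) (c : Sym2 V → C)
    {v w u : V} (hu : H.Adj v u) (huw : u ≠ w) (hc : c s(v, u) = c s(v, w)) :
    colorDegree H c v ≤ colorDegree (H.deleteEdges {s(v, w)}) c v := by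
  refine Set.ncard_le_ncard ?_ ((Set.finite_range fun x => c s(v, x)).subset ?_)
  · rintro col ⟨x, hx, rfl⟩
    by_cases hxw : x = w
    · subst hxw
      refine ⟨u, ?_, hc⟩
      rw [SimpleGraph.deleteEdges_adj]
      exact ⟨hu, fun h => huw (Sym2.congr_right.mp h)⟩
    · refine ⟨x, ?_, rfl⟩
      rw [SimpleGraph.deleteEdges_adj]
      exact ⟨hx, fun h => hxw (Sym2.congr_right.mp h)⟩
  · rintro col ⟨x, -, rfl⟩
    exact ⟨x, rfl⟩

theorem monoGraph_adj {V C : Type*} (G : SimpleGraph V) (c : Sym2 V → C) (col : C) (v w : V) :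
    (monoGraph G c col).Adj v w ↔ G.Adj v w ∧ c s(v, w) = col := by
  simp only [monoGraph, SimpleGraph.fromEdgeSet_adj, Set.mem_ofPred_eq, SimpleGraph.mem_edgeSet]
  exact ⟨fun h => h.1, fun h => ⟨h, h.1.ne⟩⟩

/-- If every edge of a graph has an endpoint of degree one, then all edges of any connected
component share a common vertex. -/
theorem SimpleGraph.ConnectedComponent.exists_forall_mem_of_pendant_edges {V : Type*}
    {M : SimpleGraph V}
    (hM : ∀ v w, M.Adj v w → (∀ u, M.Adj v u → u = w) ∨ (∀ u, M.Adj w u → u = v))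
    (comp : M.ConnectedComponent) :
    ∃ x : V, ∀ e ∈ M.edgeSet, (∃ y ∈ e, y ∈ comp.supp) → x ∈ e := by
  obtain ⟨x, hx, hleaf⟩ : ∃ x, M.connectedComponentMk x = comp ∧
      ∀ z, M.Adj x z → ∀ u, M.Adj z u → u = x := by
    induction comp using SimpleGraph.ConnectedComponent.ind with | _ y
    by_cases hy : ∀ z, M.Adj y z → ∀ u, M.Adj z u → u = y
    · exact ⟨y, rfl, hy⟩
    · push Not at hy
      obtain ⟨z, hyz, u, hzu, huy⟩ := hy
      refine ⟨z, SimpleGraph.ConnectedComponent.sound hyz.symm.reachable, fun t hzt => ?_⟩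
      refine (hM z t hzt).resolve_left fun h => huy ?_
      rw [h u hzu, h y hyz.symm]
  have hstar : ∀ y, M.Reachable x y → y = x ∨ M.Adj x y := by
    intro y hy
    rw [SimpleGraph.reachable_iff_reflTransGen] at hy
    induction hy with
    | refl => exact Or.inl rfl
    | tail _ hbc ih =>
      rcases ih with rfl | h
      · exact Or.inr hbc
      · exact Or.inl (hleaf _ h _ hbc)
  refine ⟨x, ?_⟩
  rintro e he ⟨y, hye, hy⟩
  obtain ⟨z, rfl⟩ := Sym2.mem_iff_exists.mp hye
  rw [SimpleGraph.mem_edgeSet] at he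
  rw [SimpleGraph.ConnectedComponent.mem_supp_iff, ← hx] at hy
  rcases hstar y (SimpleGraph.ConnectedComponent.exact hy).symm with rfl | h
  · exact Sym2.mem_mk_left _ _
  · rw [hleaf y h z he]
    exact Sym2.mem_mk_right _ _


/-- If for every edge `e = vw` of `H`, deleting `e` decreases the color degree
of at least one of its endpoints, then every monochromatic component of `H` is
a star, i.e. all the edges of the component share a common vertex. -/
theorem mono_components_are_stars {V C : Type*} [Fintype V]
    (H : SimpleGraph V) (c : Sym2 V → C)
    (hdel : ∀ v w, H.Adj v w →
      colorDegree (H.deleteEdges {s(v, w)}) c v < colorDegree H c v ∨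
      colorDegree (H.deleteEdges {s(v, w)}) c w < colorDegree H c w) :
    ∀ col : C, ∀ comp : (monoGraph H c col).ConnectedComponent,
      ∃ x : V, ∀ e ∈ (monoGraph H c col).edgeSet,
        (∃ y ∈ e, y ∈ comp.supp) → x ∈ e := by
  intro col comp
  refine comp.exists_forall_mem_of_pendant_edges fun v w hvw => ?_
  simp only [monoGraph_adj] at hvw ⊢
  obtain ⟨hadj, hcol⟩ := hvw
  refine (hdel v w hadj).imp (fun hlt u hu => ?_) fun hlt u hu => ?_
  · by_contra huw
    exact hlt.not_ge (colorDegree_le_deleteEdges H c hu.1 huw (hu.2.trans hcol.symm))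
  · by_contra huv
    rw [Sym2.eq_swap] at hlt hcol
    exact hlt.not_ge (colorDegree_le_deleteEdges H c hu.1 huv (hu.2.trans hcol.symm))
end

section
/- Let D be a regular tournament on m vertices with m ≥ 5. Then for every arc e of D, the digraph D − e obtained by deleting the arc e is strongly connected. -/
/-- Let `D = (V, r)` be a regular tournament on `m ≥ 5` vertices (`m` odd,
every out-degree equal to `(m - 1) / 2`).  Then for every arc `(a, b)` of `D`,
the digraph `D - (a, b)` obtained by deleting this arc is strongly connected. -/
theorem regular_tournament_minus_arc_strongly_connected {V : Type*} [Fintype V]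
    (m : ℕ) (hcard : Fintype.card V = m) (hodd : Odd m) (hm : 5 ≤ m)
    (r : V → V → Prop)
    (hirr : ∀ v, ¬ r v v)
    (htour : ∀ u v : V, u ≠ v → (r u v ↔ ¬ r v u))
    (hreg : ∀ v : V, {w | r v w}.ncard = (m - 1) / 2)
    (a b : V) (hab : r a b) :
    ∀ u v : V, Relation.ReflTransGen (fun x y => r x y ∧ ¬(x = a ∧ y = b)) u v := by
  intro u v
  by_contra hv
  obtain ⟨k, hk⟩ := hodd
  have hmk : (m - 1) / 2 = k := by omega
  rw [hmk] at hreg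
  set S : Set V :=
    {x | Relation.ReflTransGen (fun x y => r x y ∧ ¬(x = a ∧ y = b)) u x}
  have huS : u ∈ S := Relation.ReflTransGen.refl
  have hcl : ∀ x ∈ S, ∀ y ∉ S, r x y → x = a ∧ y = b := fun x hx y hy hxy => by
    by_contra h
    exact hy (Relation.ReflTransGen.tail hx ⟨hxy, h⟩)
  have hback : ∀ x ∈ S, ∀ y ∉ S, ¬(x = a ∧ y = b) → r y x := fun x hx y hy hne =>
    (htour y x fun h => hy (h ▸ hx)).2 fun hxy => hne (hcl x hx y hy hxy)
  by_cases hSa : ∀ x ∈ S, x = a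
  · have hsub : {w | r a w} ⊆ {b} := fun w hw =>
      (hcl a (hSa u huS ▸ huS) w (fun h => hirr a (by simpa [hSa w h] using hw)) hw).2
    have := Set.ncard_le_ncard hsub
    rw [hreg, Set.ncard_singleton] at this
    omega
  push Not at hSa
  obtain ⟨x, hx, hxa⟩ := hSa
  by_cases hTb : ∀ y ∉ S, y = b
  · have hbS : b ∉ S := hTb v hv ▸ hv
    have hsub : ({a, b} : Set V)ᶜ ⊆ {w | r b w} := fun w hw => by
      simp only [Set.mem_compl_iff, Set.mem_insert_iff, Set.mem_singleton_iff, not_or] at hw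
      exact hback w (by_contra fun h => hw.2 (hTb w h)) b hbS fun h => hw.1 h.1
    have hle := Set.ncard_le_ncard hsub
    have hadd := Set.ncard_add_ncard_compl ({a, b} : Set V)
    have hpair := Set.ncard_insert_le a {b}
    rw [hreg] at hle
    rw [Nat.card_eq_fintype_card] at hadd
    rw [Set.ncard_singleton] at hpair
    omega
  push Not at hTb
  obtain ⟨y, hy, hyb⟩ := hTb
  have hle : S.ncard ≤ k := hreg y ▸
    Set.ncard_le_ncard fun w hw => hback w hw y hy fun h => hyb h.2
  have hlt : k < S.ncard := hreg x ▸ Set.ncard_lt_ncard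
    ((Set.ssubset_iff_of_subset fun w hw => by_contra fun h => hxa (hcl x hx w h hw).1).2
      ⟨x, hx, hirr x⟩)
  omega
end

section
/- Let D be a strongly connected tournament on vertices v_1,…,v_m and let c_1,…,c_m be pairwise distinct colors. Color the edges of the complete graph K on {v_1,…,v_m} by giving the edge v_i v_j the color c_i whenever (v_i, v_j) is an arc of D. Then for every i ∈ [m], the edge-colored complete graph K has a rainbow spanning tree containing no edge of color c_i. -/
/-- If every vertex reaches `i` along `r`, then `r`-steps can be chosen at all other vertices so
that they strictly decrease some natural-number height. -/
theorem Relation.exists_parent_height_lt {V : Type*} {r : V → V → Prop} {i : V}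
    (h : ∀ v, Relation.ReflTransGen r v i) :
    ∃ (parent : V → V) (height : V → ℕ),
      ∀ v, v ≠ i → r v (parent v) ∧ height (parent v) < height v := by
  let reaches : ℕ → V → Prop := fun n ↦ n.rec (· = i) fun _ P v ↦ ∃ w, r v w ∧ P w
  have hreaches : ∀ v, ∃ n, reaches n v := fun v ↦ by
    induction h v using Relation.ReflTransGen.head_induction_on with
    | refl => exact ⟨0, rfl⟩
    | head hvw _ ih => exact ih.imp' (· + 1) fun _ hn ↦ ⟨_, hvw, hn⟩
  have hmin : ∀ v, ∃ n, reaches n v ∧ ∀ m, reaches m v → n ≤ m := fun v ↦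
    ⟨sInf {n | reaches n v}, Nat.sInf_mem (hreaches v), fun _ hm ↦ Nat.sInf_le hm⟩
  choose height hheight hle using hmin
  have hstep : ∀ v, ∃ w, v ≠ i → r v w ∧ height w < height v := fun v ↦ by
    have hv := hheight v
    cases hn : height v with rw [hn] at hv
    | zero => exact ⟨v, fun hne ↦ (hne hv).elim⟩
    | succ n =>
      obtain ⟨w, hvw, hw⟩ := hv
      exact ⟨w, fun _ ↦ ⟨hvw, Nat.lt_succ_of_le (hle w n hw)⟩⟩
  choose parent hparent using hstep
  exact ⟨parent, height, hparent⟩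

/-- A parent function that decreases a height at every vertex other than `i` induces a tree. -/
theorem SimpleGraph.exists_isTree_edgeSet_subset_of_height_lt {V : Type*} {i : V} {parent : V → V}
    {height : V → ℕ} (h : ∀ v, v ≠ i → height (parent v) < height v) :
    ∃ T : SimpleGraph V, T.IsTree ∧ T.edgeSet ⊆ {e | ∃ v, v ≠ i ∧ s(v, parent v) = e} := by
  let G : SimpleGraph V := .fromEdgeSet {e | ∃ v, v ≠ i ∧ s(v, parent v) = e}
  have hreach : ∀ v, G.Reachable v i := fun v ↦ by
    induction hn : height v using Nat.strong_induction_on generalizing v with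
    | _ n ih =>
      by_cases hv : v = i
      · rw [hv]
      · have hlt := h v hv
        have hadj : G.Adj v (parent v) :=
          (SimpleGraph.fromEdgeSet_adj _).2 ⟨⟨v, hv, rfl⟩,
            fun he ↦ hlt.ne (congrArg height he.symm)⟩
        exact hadj.reachable.trans (ih _ (hn ▸ hlt) _ rfl)
  have hconn : G.Connected :=
    { preconnected := fun u v ↦ (hreach u).trans (hreach v).symm, nonempty := ⟨i⟩ }
  obtain ⟨T, hTG, hT⟩ := hconn.exists_isTree_le
  refine ⟨T, hT, (SimpleGraph.edgeSet_mono hTG).trans ?_⟩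
  rw [SimpleGraph.edgeSet_fromEdgeSet]
  exact Set.sdiff_subset

/-- Let `D = (V, r)` be a strongly connected tournament, and color the edges of
the complete graph on `V` by pairwise distinct colors `col i`, giving edge
`{i, j}` the color `col i` whenever `(i, j)` is an arc of `D`.  Then for every
vertex `i`, the edge-colored complete graph has a rainbow spanning tree
containing no edge of color `col i`. -/
theorem rainbow_spanning_tree_avoiding_color {V C : Type*} [Fintype V]
    (r : V → V → Prop)
    (hirr : ∀ v, ¬ r v v)
    (htour : ∀ u v : V, u ≠ v → (r u v ↔ ¬ r v u))
    (hstrong : ∀ u v : V, Relation.ReflTransGen r u v)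
    (col : V → C) (hcol : Function.Injective col)
    (c : Sym2 V → C) (hc : ∀ i j : V, r i j → c s(i, j) = col i)
    (i : V) :
    ∃ T : (⊤ : SimpleGraph V).Subgraph,
      T.verts = Set.univ ∧ T.coe.IsTree ∧
      (∀ e ∈ T.edgeSet, ∀ f ∈ T.edgeSet, c e = c f → e = f) ∧
      (∀ e ∈ T.edgeSet, c e ≠ col i) := by
  obtain ⟨parent, height, h⟩ := Relation.exists_parent_height_lt fun v ↦ hstrong v i
  obtain ⟨T, hT, hedge⟩ :=
    SimpleGraph.exists_isTree_edgeSet_subset_of_height_lt fun v hv ↦ (h v hv).2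
  have hspan := SimpleGraph.toSubgraph.isSpanning T (le_top : T ≤ ⊤)
  have hcolor : ∀ v, v ≠ i → c s(v, parent v) = col v := fun v hv ↦ hc _ _ (h v hv).1
  refine ⟨SimpleGraph.toSubgraph T le_top, rfl,
    (SimpleGraph.Subgraph.spanningCoeEquivCoeOfSpanning _ hspan).isTree_iff.1 hT, ?_, ?_⟩
  · intro e he f hf hef
    obtain ⟨v, hv, rfl⟩ := hedge he
    obtain ⟨w, hw, rfl⟩ := hedge hf
    rw [hcolor v hv, hcolor w hw] at hef
    rw [hcol hef]
  · intro e he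
    obtain ⟨v, hv, rfl⟩ := hedge he
    rw [hcolor v hv]
    exact hcol.ne hv
end

section
/- Let D be a regular tournament on vertices v_1,…,v_m with m ≥ 5, and let c_1,…,c_m be pairwise distinct colors. Color the edges of the complete graph K on {v_1,…,v_m} by giving the edge v_i v_j the color c_i whenever (v_i, v_j) is an arc of D. Then for every edge e of K and every i ∈ [m], the graph K − e has a rainbow spanning tree containing no edge of color c_i. -/
open Finset in
/-- In a regular tournament on at least five vertices, every nonempty proper vertex set is left by
at least one arc other than any prescribed edge. -/
theorem exists_arc_leaving_ne {V : Type*} [Fintype V] [DecidableEq V] {k : ℕ}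
    (hcard : Fintype.card V = 2 * k + 1) (hk : 2 ≤ k)
    {r : V → V → Prop} [DecidableRel r] (hirr : ∀ v, ¬ r v v)
    (htour : ∀ u v : V, u ≠ v → (r u v ↔ ¬ r v u))
    (hreg : ∀ v : V, #{w | r v w} = k)
    (e : Sym2 V) {S : Finset V} (hne : S.Nonempty) (hS : S ≠ univ) :
    ∃ u ∈ S, ∃ w ∉ S, r u w ∧ s(u, w) ≠ e := by
  by_contra! hcut
  have hsplit : ∀ u, #{w ∈ S | r u w} + #{w ∈ Sᶜ | r u w} = k := by
    intro u
    rw [← hreg u, ← card_union_of_disjoint, ← filter_union, union_compl]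
    exact disjoint_filter_filter disjoint_compl_right
  have hpair : ∀ u ∈ S, #{w ∈ S | r u w} + #{w ∈ S | r w u} + 1 = #S := by
    intro u hu
    rw [← card_erase_add_one hu, ← card_union_of_disjoint]
    · congr 2
      ext w
      have := htour u w
      have := hirr u
      simp only [mem_union, mem_filter, mem_erase]
      grind
    · rw [disjoint_filter]
      intro w _ h h'
      have := htour u w
      have := hirr u
      grind
  have hinside : ∑ u ∈ S, #{w ∈ S | r u w} = ∑ u ∈ S, #{w ∈ S | r w u} :=
    sum_card_bipartiteAbove_eq_sum_card_bipartiteBelow r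
  have hleave : ∑ u ∈ S, #{w ∈ Sᶜ | r u w} ≤ 1 := by
    rw [← card_sigma, card_le_one]
    rintro ⟨u, w⟩ h ⟨u', w'⟩ h'
    simp only [mem_sigma, mem_filter, mem_compl] at h h'
    have heq := (hcut u h.1 w h.2.1 h.2.2).trans (hcut u' h'.1 w' h'.2.1 h'.2.2).symm
    rw [Sym2.eq_iff] at heq
    grind
  have hsum := sum_congr (rfl : S = S) fun u _ => hsplit u
  have hsum' := sum_congr rfl hpair
  simp only [sum_add_distrib, sum_const, smul_eq_mul, mul_one] at hsum hsum'
  have hlt : #S < 2 * k + 1 := by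
    rw [← hcard]
    exact card_lt_iff_ne_univ S |>.2 hS
  have hpos := hne.card_pos
  nlinarith

/-- If every nonempty vertex set avoiding `i` is left by an arc of `r`, then every vertex other
than `i` has an out-neighbor that is closer to `i`. -/
theorem exists_rank_lt_of_cut {V : Type*} {r : V → V → Prop} {i : V}
    (hcut : ∀ S : Set V, S.Nonempty → i ∉ S → ∃ u ∈ S, ∃ w ∉ S, r u w) :
    ∃ d : V → ℕ, ∀ v, v ≠ i → ∃ w, r v w ∧ d w < d v := by
  classical
  let L : ℕ → Set V := fun n => (fun A : Set V => {v | v ∈ A ∨ ∃ w ∈ A, r v w})^[n] {i}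
  have hsucc : ∀ n, L (n + 1) = {v | v ∈ L n ∨ ∃ w ∈ L n, r v w} :=
    fun n => Function.iterate_succ_apply' _ _ _
  have hL : ∀ v : V, ∃ n : ℕ, v ∈ L n := by
    by_contra! h
    obtain ⟨u, hu, w, hw, huw⟩ := hcut {v | ∀ n, v ∉ L n} h fun hi => hi 0 rfl
    simp only [Set.mem_ofPred_eq, not_forall, not_not] at hu hw
    obtain ⟨n, hn⟩ := hw
    exact hu (n + 1) (hsucc n ▸ Or.inr ⟨w, hn, huw⟩)
  refine ⟨fun v => Nat.find (hL v), fun v hv => ?_⟩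
  have hmem := Nat.find_spec (hL v)
  cases hn : Nat.find (hL v) with
  | zero =>
    rw [hn] at hmem
    exact absurd hmem hv
  | succ n =>
    rw [hn, hsucc] at hmem
    obtain hmem | ⟨w, hw, hvw⟩ := hmem
    · exact absurd hmem (Nat.find_min (hL v) (by omega))
    · exact ⟨w, hvw, (Nat.lt_succ_of_le (Nat.find_min' (hL w) hw)).trans_eq hn.symm⟩

/-- Joining every vertex other than `i` to a vertex of smaller rank yields a spanning tree. -/
theorem isTree_fromEdgeSet_of_rank_lt {V : Type*} [Fintype V] {i : V} {f : V → V} {d : V → ℕ}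
    (hf : ∀ v, v ≠ i → d (f v) < d v) :
    (SimpleGraph.fromEdgeSet ((fun v => s(v, f v)) '' {i}ᶜ)).IsTree := by
  classical
  set G := SimpleGraph.fromEdgeSet ((fun v => s(v, f v)) '' {i}ᶜ)
  have hadj : ∀ v, v ≠ i → G.Adj v (f v) := by
    intro v hv
    refine (SimpleGraph.fromEdgeSet_adj _).2 ⟨⟨v, hv, rfl⟩, fun h => ?_⟩
    have := hf v hv
    rw [← h] at this
    exact lt_irrefl _ this
  have hreach : ∀ n v, d v = n → G.Reachable v i := by
    intro n
    induction n using Nat.strong_induction_on with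
    | _ n ih =>
      rintro v rfl
      by_cases hv : v = i
      · exact hv ▸ SimpleGraph.Reachable.refl _
      · exact (hadj v hv).reachable.trans (ih _ (hf v hv) _ rfl)
  have hconn : G.Connected :=
    { preconnected := fun u v => (hreach _ u rfl).trans (hreach _ v rfl).symm
      nonempty := ⟨i⟩ }
  refine SimpleGraph.isTree_iff_connected_and_card.2 ⟨hconn, le_antisymm ?_
    hconn.card_vert_le_card_edgeSet_add_one⟩
  have hsub : G.edgeSet ⊆ (fun v => s(v, f v)) '' {i}ᶜ := by
    rw [SimpleGraph.edgeSet_fromEdgeSet]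
    exact Set.sdiff_subset
  have hle := (Set.ncard_le_ncard hsub (Set.toFinite _)).trans
    (Set.ncard_image_le (Set.toFinite _))
  have hcompl := Set.ncard_add_ncard_compl ({i} : Set V)
  rw [Set.ncard_singleton] at hcompl
  rw [Nat.card_coe_set_eq]
  omega


/-- Let `D = (V, r)` be a regular tournament on `m ≥ 5` vertices (`m` odd,
every out-degree equal to `(m - 1) / 2`), and color the edges of the complete
graph `K` on `V` by pairwise distinct colors `col i`, giving edge `{i, j}` the
color `col i` whenever `(i, j)` is an arc of `D`.  Then for every edge `e` of
`K` and every vertex `i`, the graph `K - e` has a rainbow spanning tree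
containing no edge of color `col i`. -/
theorem rainbow_spanning_tree_avoiding_color_minus_edge {V C : Type*} [Fintype V]
    (m : ℕ) (hcard : Fintype.card V = m) (hodd : Odd m) (hm : 5 ≤ m)
    (r : V → V → Prop)
    (hirr : ∀ v, ¬ r v v)
    (htour : ∀ u v : V, u ≠ v → (r u v ↔ ¬ r v u))
    (hreg : ∀ v : V, {w | r v w}.ncard = (m - 1) / 2)
    (col : V → C) (hcol : Function.Injective col)
    (c : Sym2 V → C) (hc : ∀ i j : V, r i j → c s(i, j) = col i)
    (e : Sym2 V) (he : ¬ e.IsDiag) (i : V) :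
    ∃ T : ((⊤ : SimpleGraph V).deleteEdges {e}).Subgraph,
      T.verts = Set.univ ∧ T.coe.IsTree ∧
      (∀ e' ∈ T.edgeSet, ∀ f ∈ T.edgeSet, c e' = c f → e' = f) ∧
      (∀ e' ∈ T.edgeSet, c e' ≠ col i) := by
  classical
  obtain ⟨k, rfl⟩ := hodd
  have hdeg : ∀ v, Finset.card {w | r v w} = k := by
    intro v
    have := hreg v
    rw [Set.ncard_eq_toFinset_card', Set.toFinset_ofPred] at this
    rw [this]
    omega
  obtain ⟨d, hd⟩ := exists_rank_lt_of_cut (r := fun u w => r u w ∧ s(u, w) ≠ e) (i := i) <| by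
    intro S hne hi
    simpa using exists_arc_leaving_ne hcard (by omega) hirr htour hdeg e (S := S.toFinset)
      (by simpa using hne) fun h => hi (Set.mem_toFinset.1 (h ▸ Finset.mem_univ i))
  choose! f hf using hd
  have htree := isTree_fromEdgeSet_of_rank_lt fun v hv => (hf v hv).2
  set G := SimpleGraph.fromEdgeSet ((fun v => s(v, f v)) '' {i}ᶜ)
  have hedge : ∀ e' ∈ G.edgeSet, ∃ v, v ≠ i ∧ e' = s(v, f v) := by
    intro e' he'
    rw [SimpleGraph.edgeSet_fromEdgeSet] at he'
    obtain ⟨⟨v, hv, rfl⟩, -⟩ := he'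
    exact ⟨v, hv, rfl⟩
  have hcolor : ∀ v, v ≠ i → c s(v, f v) = col v := fun v hv => hc _ _ (hf v hv).1.1
  have hle : G ≤ (⊤ : SimpleGraph V).deleteEdges {e} := by
    intro u w huw
    obtain ⟨v, hv, heq⟩ := hedge s(u, w) huw
    rw [SimpleGraph.deleteEdges_adj, Set.mem_singleton_iff, heq]
    exact ⟨huw.ne, (hf v hv).1.2⟩
  have hspan := SimpleGraph.toSubgraph.isSpanning G hle
  refine ⟨SimpleGraph.toSubgraph G hle, rfl, ?_, ?_, ?_⟩
  · exact (SimpleGraph.Subgraph.spanningCoeEquivCoeOfSpanning _ hspan).isTree_iff.1 htree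
  · intro e₁ h₁ e₂ h₂ heq
    obtain ⟨v, hv, rfl⟩ := hedge e₁ h₁
    obtain ⟨w, hw, rfl⟩ := hedge e₂ h₂
    rw [hcolor v hv, hcolor w hw] at heq
    rw [hcol heq]
  · intro e₁ h₁ heq
    obtain ⟨v, hv, rfl⟩ := hedge e₁ h₁
    rw [hcolor v hv] at heq
    exact hv (hcol heq)
end

section
/- Let G be an edge-colored connected graph, and let T be a rainbow tree in G whose vertex set V(T) is a proper subset of V(G). Suppose there exist r pairwise distinct colors c_1,…,c_r with r ≤ |V(T)| − 1 such that every edge of G with exactly one endpoint in V(T) has its color among c_1,…,c_r, and deleting from the induced subgraph G[V(T)] all edges whose color lies in {c_1,…,c_r} leaves a graph with exactly r+1 connected components. Then G has no rainbow spanning tree. -/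
/-- A set of edges is rainbow: no two distinct edges have the same color. -/
def RainbowOn {V C : Type*} (c : Sym2 V → C) (E : Set (Sym2 V)) : Prop :=
  ∀ e ∈ E, ∀ f ∈ E, c e = c f → e = f

/-- The graph obtained from the induced subgraph `G[X]` by deleting all edges
whose color lies in `S`. -/
def residualGraph {V C : Type*} (G : SimpleGraph V) (c : Sym2 V → C)
    (X : Set V) (S : Set C) : SimpleGraph X :=
  SimpleGraph.fromRel (fun a b => G.Adj a.1 b.1 ∧ c s(a.1, b.1) ∉ S)

open SimpleGraph in
/-- A surjective image of a connected graph is connected. -/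
theorem SimpleGraph.Connected.map_of_surjective {V W : Type*} {H : SimpleGraph V}
    (hH : H.Connected) {f : V → W} (hf : Function.Surjective f) :
    (H.map f).Connected := by
  have hwalk : ∀ {x y : V}, H.Walk x y → (H.map f).Reachable (f x) (f y) := by
    intro x y p
    induction p with
    | nil => rfl
    | @cons u v w huv _ ih =>
      refine Reachable.trans ?_ ih
      by_cases h : f u = f v
      · rw [h]
      · exact Adj.reachable (map_adj_apply' huv h)
  have : Nonempty W := hH.nonempty.map f
  refine ⟨fun a b => ?_⟩
  obtain ⟨x, rfl⟩ := hf a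
  obtain ⟨y, rfl⟩ := hf b
  exact (hH.preconnected x y).elim hwalk

open SimpleGraph in
/-- If the edges of a connected rainbow graph joining distinct fibers of a surjection `f` use only
colors from a finite family, then the number of fibers is at most the size of the family plus
one. -/
theorem card_le_card_add_one_of_rainbowOn {V W C ι : Type*} [Finite ι]
    {H : SimpleGraph V} (hH : H.Connected) {f : V → W} (hf : Function.Surjective f)
    {c : Sym2 V → C} (cs : ι → C) (hrb : RainbowOn c H.edgeSet)
    (hcol : ∀ x y, H.Adj x y → f x ≠ f y → c s(x, y) ∈ Set.range cs) :
    Nat.card W ≤ Nat.card ι + 1 := by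
  have hlift : ∀ e : (H.map f).edgeSet, ∃ d ∈ H.edgeSet, d.map f = e ∧ ∃ i, cs i = c d := by
    rintro ⟨e, he⟩
    induction e using Sym2.ind with
    | _ a b =>
      obtain ⟨hne, x, y, hxy, rfl, rfl⟩ := (mem_edgeSet _).mp he
      exact ⟨s(x, y), hxy, rfl, hcol x y hxy hne⟩
  choose d hd hdf i hi using hlift
  have hinj : Function.Injective i := fun e e' h => by
    have := hrb _ (hd e) _ (hd e') (by rw [← hi, ← hi, h])
    exact Subtype.ext (by rw [← hdf, ← hdf, this])
  calc Nat.card W ≤ Nat.card (H.map f).edgeSet + 1 :=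
        (hH.map_of_surjective hf).card_vert_le_card_edgeSet_add_one
    _ ≤ Nat.card ι + 1 := Nat.add_le_add_right (Nat.card_le_card_of_injective i hinj) 1

open SimpleGraph in
/-- Let `G` be an edge-colored connected graph and `T` a rainbow tree in `G`
spanning a proper subset of the vertices.  If there are `r ≤ |V(T)| - 1`
pairwise distinct colors `c_1, …, c_r` such that every edge of `G` with exactly
one endpoint in `V(T)` has its color among them, and deleting from `G[V(T)]`
all edges with color among them leaves exactly `r + 1` connected components,
then `G` has no rainbow spanning tree. -/
theorem no_rainbow_spanning_tree {V C : Type*} [Fintype V]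
    (G : SimpleGraph V) (c : Sym2 V → C) (hG : G.Connected)
    (T : G.Subgraph) (hTtree : T.coe.IsTree) (hTrb : RainbowOn c T.edgeSet)
    (hTproper : T.verts ≠ Set.univ)
    (r : ℕ) (cs : Fin r → C) (hinj : Function.Injective cs)
    (hr : r ≤ T.verts.ncard - 1)
    (hbd : ∀ x y : V, G.Adj x y → x ∈ T.verts → y ∉ T.verts → ∃ i, c s(x, y) = cs i)
    (hcomp : Nat.card (residualGraph G c T.verts (Set.range cs)).ConnectedComponent = r + 1) :
    ¬ ∃ T' : G.Subgraph, T'.verts = Set.univ ∧ T'.coe.IsTree ∧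
        RainbowOn c T'.edgeSet := by
  rintro ⟨T', hverts, htree, hrb⟩
  set R := residualGraph G c T.verts (Set.range cs) with hR
  have hconn : T'.spanningCoe.Connected :=
    (T'.spanningCoeEquivCoeOfSpanning
      (Subgraph.isSpanning_iff.mpr hverts)).connected_iff.mpr htree.connected
  classical
  let f : V → Option R.ConnectedComponent := fun v =>
    if hv : v ∈ T.verts then some (R.connectedComponentMk ⟨v, hv⟩) else none
  have hf : Function.Surjective f := by
    rintro (_ | k)
    · obtain ⟨v, hv⟩ := (Set.ne_univ_iff_exists_notMem _).mp hTproper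
      exact ⟨v, dif_neg hv⟩
    · induction k using ConnectedComponent.ind with
      | h v => exact ⟨v.1, dif_pos v.2⟩
  have hcol : ∀ x y, T'.spanningCoe.Adj x y → f x ≠ f y → c s(x, y) ∈ Set.range cs := by
    intro x y hxy hne
    have hG' : G.Adj x y := T'.adj_sub hxy
    by_cases hx : x ∈ T.verts <;> by_cases hy : y ∈ T.verts
    · by_contra hS
      refine hne ?_
      simp only [f, hx, hy, dif_pos, Option.some.injEq]
      refine ConnectedComponent.sound (Adj.reachable ?_)
      rw [hR, residualGraph, fromRel_adj]
      exact ⟨fun h => hG'.ne (congrArg Subtype.val h), Or.inl ⟨hG', hS⟩⟩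
    · obtain ⟨i, hi⟩ := hbd x y hG' hx hy
      exact ⟨i, hi.symm⟩
    · obtain ⟨i, hi⟩ := hbd y x hG'.symm hy hx
      exact ⟨i, by rw [Sym2.eq_swap, hi]⟩
    · exact absurd (by simp [f, hx, hy]) hne
  have hcard := card_le_card_add_one_of_rainbowOn hconn hf cs (by simpa using hrb) hcol
  have : Nat.card (Option R.ConnectedComponent) = r + 2 := by
    rw [Finite.card_option, hcomp]
  simp only [Nat.card_eq_fintype_card, Fintype.card_fin] at hcard this
  omega
end

section
/- Let G be a connected star-colored edge-colored graph and let T be a rainbow tree in G whose vertex set V(T) is a proper subset of V(G). Suppose there exist r pairwise distinct colors c_1,…,c_r, each appearing on an edge of T, such that every edge of G with exactly one endpoint in V(T) has its color among c_1,…,c_r, and deleting from the induced subgraph G[V(T)] all edges whose color lies in {c_1,…,c_r} leaves a graph with exactly r+1 connected components. Then |V(T)| ≥ 2δ^c(G). -/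
/-- The minimum color degree of `G`. -/
noncomputable def minColorDegree {V C : Type*} (G : SimpleGraph V) (c : Sym2 V → C) : ℕ :=
  sInf (Set.range (colorDegree G c))

open Finset in
/-- The arithmetic core: `n k` is the size of the `k`-th class and `m k` is the number of
distinguished elements in it. -/
lemma two_mul_le_sum_of_weighted_bounds {K : Type*} [Fintype K] [DecidableEq K]
    (n m : K → ℤ) (r M δ : ℤ) (hK : (Fintype.card K : ℤ) = r + 1)
    (hn : ∀ k, 1 ≤ n k) (hm : ∀ k, 0 ≤ m k) (hmn : ∀ k, m k ≤ n k)
    (hM : ∑ k, m k = M) (hM1 : 1 ≤ M) (hMr : M ≤ r)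
    (havg : 2 * (M * δ) ≤ 2 * ∑ k, m k * (n k - 1) + 2 * r + M ^ 2 - ∑ k, m k ^ 2)
    (hzero : ∀ k, m k = 0 → δ ≤ n k - 1 + M) :
    2 * δ ≤ ∑ k, n k := by
  by_contra! hlt
  set h : K → ℤ := fun k => max 1 (m k) with h_def
  have h1 : ∀ k, 1 ≤ h k := fun k => le_max_left _ _
  have hmh : ∀ k, m k ≤ h k := fun k => le_max_right _ _
  have he : ∀ k, 0 ≤ n k - h k := fun k => sub_nonneg.2 (max_le (hn k) (hmn k))
  have hmm : ∀ k, m k * h k = m k ^ 2 := by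
    intro k
    rcases (hm k).eq_or_lt with h0 | h0
    · rw [← h0]; ring
    · rw [show h k = m k from max_eq_right (by omega)]; ring
  set H := ∑ k, h k with H_def
  set E := ∑ k, (n k - h k) with E_def
  have ht : ∑ k, n k = H + E := by rw [E_def, sum_sub_distrib]; ring
  have hH : ∑ k, (h k - 1) = H - (r + 1) := by
    rw [sum_sub_distrib, ← H_def]; simp [hK]
  set Q := ∑ k, m k ^ 2 with Q_def
  have hsplit : ∑ k, m k * (n k - 1) = Q + ∑ k, m k * (n k - h k) - M := by
    rw [← hM, Q_def, ← sum_add_distrib, ← sum_sub_distrib]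
    refine sum_congr rfl fun k _ => ?_
    rw [← hmm]; ring
  have hne : (univ : Finset K).Nonempty := by
    rw [univ_nonempty_iff, ← Fintype.card_pos_iff]; omega
  obtain ⟨d, -, hd⟩ := exists_max_image univ m hne
  have hd' : ∀ k, m k ≤ m d := fun k => hd k (mem_univ k)
  set μ := m d
  have hμ1 : 1 ≤ μ := by
    by_contra! hμ
    have : M ≤ 0 := by
      rw [← hM]; exact sum_nonpos fun k _ => by have := hd' k; omega
    omega
  have hμM : μ ≤ M := by
    rw [← hM]; exact single_le_sum (fun k _ => hm k) (mem_univ d)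
  have hμH : μ + r ≤ H := by
    have := single_le_sum (f := fun k => h k - 1) (fun k _ => by have := h1 k; simp; omega)
      (mem_univ d)
    have h2 := hmh d
    omega
  have hQ : Q ≤ M * μ := by
    rw [Q_def, ← hM, sum_mul]
    exact sum_le_sum fun k _ => by nlinarith [hd' k, hm k]
  rw [hsplit] at havg
  rw [ht] at hlt
  rcases le_or_gt (2 * μ) M with hc | hc
  · have hme : 2 * ∑ k, m k * (n k - h k) ≤ M * E := by
      rw [E_def, mul_sum, mul_sum]
      exact sum_le_sum fun k _ => by nlinarith [hd' k, he k]
    have h2 : M * (H + E + 1) ≤ M * (2 * δ) := mul_le_mul_of_nonneg_left (by omega) (by omega)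
    have h3 : M * μ ≤ M * (H - r) := mul_le_mul_of_nonneg_left (by omega) (by omega)
    nlinarith [mul_nonneg (show 0 ≤ M - 2 by omega) (show 0 ≤ r - M by omega)]
  · obtain ⟨a, ha⟩ : ∃ a, m a = 0 := by
      by_contra! hall
      have : ∑ _k : K, (1 : ℤ) ≤ M := by
        rw [← hM]
        exact sum_le_sum fun k _ => by have := hm k; have := hall k; omega
      simp [hK] at this
      omega
    have hha : h a = 1 := by simp [h_def, ha]
    have hza := hzero a ha
    have hme : ∑ k, m k * (n k - h k) + (2 * μ - M) * (n a - 1) ≤ μ * E := by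
      have : (2 * μ - M) * (n a - 1) = ∑ k, if k = a then (2 * μ - M) * (n k - h k) else 0 := by
        simp [hha]
      rw [this, ← sum_add_distrib, E_def, mul_sum]
      refine sum_le_sum fun k _ => ?_
      split_ifs with hk
      · subst hk
        rw [ha]
        nlinarith [he k]
      · nlinarith [hd' k, he k]
    have hother : ∀ k ∈ univ.erase d, m k ≤ H - μ - r + 1 := by
      intro k hk
      have h2 : ∑ j ∈ {d, k}, (h j - 1) ≤ ∑ j, (h j - 1) :=
        sum_le_sum_of_subset_of_nonneg (subset_univ _) fun j _ _ => by
          have := h1 j; omega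
      rw [sum_pair (ne_of_mem_erase hk).symm, hH] at h2
      have h3 := hmh d
      have h4 := hmh k
      omega
    have hQ' : Q ≤ μ ^ 2 + (M - μ) * (H - μ - r + 1) := by
      have hs : M - μ = ∑ k ∈ univ.erase d, m k := by
        rw [← hM, ← add_sum_erase univ m (mem_univ d)]; ring
      rw [Q_def, ← add_sum_erase univ _ (mem_univ d), hs, sum_mul]
      gcongr with k hk
      nlinarith [hother k hk, hm k]
    have h2 : M * (H + E + 1) ≤ M * (2 * δ) := mul_le_mul_of_nonneg_left (by omega) (by omega)
    have h3 : (2 * μ - M) * (H + E + 3) ≤ (2 * μ - M) * (2 * (n a - 1) + 2 + 2 * M) :=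
      mul_le_mul_of_nonneg_left (by omega) (by omega)
    obtain ⟨s, rfl⟩ : ∃ s, M = μ + s := ⟨M - μ, by ring⟩
    have h4 : 0 ≤ (2 * μ - s) * (H - μ - r) := mul_nonneg (by omega) (by omega)
    have h5 : 0 ≤ (μ - 1) * (r - μ - s) := mul_nonneg (by omega) (by omega)
    have h6 : 0 ≤ s ^ 2 - s := by
      have : 0 ≤ s * (s - 1) := by
        rcases (show 0 ≤ s by omega).eq_or_lt with h0 | h0
        · simp [← h0]
        · exact mul_nonneg (by omega) (by omega)
      linarith
    linarith

open Finset in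
/-- Let `comp` partition `X` into `r + 1` classes, let `x` list `r` centers in `X`, and let `R` be
an asymmetric relation.  If every `v` satisfies `δ ≤ (s - 1) + a + p`, where `s` is the size of the
class of `v`, `a` the number of indices listing `v`, and `p` the number of centers outside that
class to which `v` is related, then `X` has at least `2 * δ` elements. -/
lemma two_mul_le_card_of_asymmetric {X K : Type*} [Fintype X] [Fintype K] [DecidableEq X]
    [DecidableEq K] (comp : X → K) (hcomp : Function.Surjective comp) (r : ℕ) (hr : 0 < r)
    (hK : Fintype.card K = r + 1) (x : Fin r → X) (R : X → X → Prop) [DecidableRel R]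
    (hR : ∀ v w, R v w → ¬ R w v) (δ : ℕ)
    (hδ : ∀ v, δ + 1 ≤ #{w | comp w = comp v} + #{i | x i = v} +
      #{w ∈ univ.image x | comp w ≠ comp v ∧ R v w}) :
    2 * δ ≤ Fintype.card X := by
  set M := univ.image x
  set n : K → ℕ := fun k => #{w | comp w = k} with n_def
  let m : K → ℕ := fun k => #{w ∈ M | comp w = k}
  have hn : ∑ k, n k = Fintype.card X :=
    (card_eq_sum_card_fiberwise (f := comp) (t := univ) fun _ _ => mem_coe.2 (mem_univ _)).symm
  have hm : ∑ k, m k = #M :=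
    (card_eq_sum_card_fiberwise (f := comp) (t := univ) fun _ _ => mem_coe.2 (mem_univ _)).symm
  have hMr : #M ≤ r := by simpa using card_image_le (s := univ) (f := x)
  have hM1 : 1 ≤ #M := card_pos.2 ⟨x ⟨0, hr⟩, mem_image_of_mem _ (mem_univ _)⟩
  have hfib : ∀ f : K → ℕ, ∑ v ∈ M, f (comp v) = ∑ k, m k * f k := by
    intro f
    rw [← sum_fiberwise M comp]
    refine sum_congr rfl fun k _ => ?_
    rw [sum_congr rfl (g := fun _ => f k) (by simp +contextual), sum_const, smul_eq_mul]
  have hown : ∑ v ∈ M, #{i | x i = v} = r := by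
    rw [← card_eq_sum_card_fiberwise fun i _ => mem_image_of_mem x (mem_univ i)]
    simp
  have hpair : 2 * ∑ v ∈ M, #{w ∈ M | comp w ≠ comp v ∧ R v w} + ∑ k, m k * m k ≤ #M ^ 2 := by
    set P := ∑ v ∈ M, #{w ∈ M | comp w ≠ comp v ∧ R v w} with P_def
    have hswap : P = ∑ v ∈ M, #{w ∈ M | comp w ≠ comp v ∧ R w v} := by
      simp only [P_def, card_filter]
      rw [sum_comm]
      simp only [ne_comm]
    have : 2 * P + ∑ k, m k * m k = ∑ v ∈ M, (#{w ∈ M | comp w ≠ comp v ∧ R v w} +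
        #{w ∈ M | comp w ≠ comp v ∧ R w v} + #{w ∈ M | comp w = comp v}) := by
      rw [sum_add_distrib, sum_add_distrib, ← hswap, ← P_def, ← hfib m]; ring
    rw [this, sq, ← smul_eq_mul, ← sum_const]
    refine sum_le_sum fun v _ => ?_
    rw [card_filter, card_filter, card_filter, card_eq_sum_ones M]
    rw [← sum_add_distrib, ← sum_add_distrib]
    refine sum_le_sum fun w _ => ?_
    have := hR v w
    by_cases h1 : comp w = comp v
    · simp [h1]
    · by_cases h2 : R v w
      · simp [h1, h2, this h2]
      · simp only [h1, h2, ne_eq, not_false_eq_true, and_false, if_false, true_and]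
        split_ifs <;> simp
  have hn1 : ∀ k, 1 ≤ n k := by
    intro k
    obtain ⟨w, hw⟩ := hcomp k
    exact card_pos.2 ⟨w, by simp [hw]⟩
  have hsum := sum_le_sum fun v (_ : v ∈ M) => hδ v
  rw [sum_const, smul_eq_mul, sum_add_distrib, sum_add_distrib, hown, hfib n] at hsum
  have key := two_mul_le_sum_of_weighted_bounds (fun k => (n k : ℤ)) (fun k => (m k : ℤ))
    r (#M) δ (by exact_mod_cast hK) (fun k => by exact_mod_cast hn1 k) (fun k => by positivity)
    (fun k => by exact_mod_cast card_le_card (filter_subset_filter _ (subset_univ M)))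
    (by exact_mod_cast hm) (by exact_mod_cast hM1) (by exact_mod_cast hMr) ?_ ?_
  · have hn' : (∑ k, (n k : ℤ)) = Fintype.card X := by exact_mod_cast hn
    rw [hn'] at key
    exact_mod_cast key
  · simp only [mul_sub, mul_one, sum_sub_distrib, sq (_ : ℤ)]
    have hm' : ∑ k, (m k : ℤ) = #M := by exact_mod_cast hm
    rw [hm']
    zify at hsum hpair
    linarith
  · intro k hk
    obtain ⟨v, rfl⟩ := hcomp k
    have hk' : #{w ∈ M | comp w = comp v} = 0 := by exact_mod_cast hk
    have hv : #{i | x i = v} = 0 := by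
      rw [card_eq_zero, filter_eq_empty_iff] at hk' ⊢
      rintro i - rfl
      exact hk' (mem_image_of_mem x (mem_univ i)) rfl
    have h1 := hδ v
    have h2 : #{w ∈ M | comp w ≠ comp v ∧ R v w} ≤ #M := card_filter_le _ _
    have h3 : δ + 1 ≤ n (comp v) + #M := by
      simp only [n_def]
      omega
    zify at h3
    linarith

/-- The color degree is at most the number of colors needed to cover the incident edges. -/
lemma colorDegree_le_card {V C : Type*} (G : SimpleGraph V) (c : Sym2 V → C) (v : V)
    (S : Finset C) (hS : ∀ u, G.Adj v u → c s(v, u) ∈ S) : colorDegree G c v ≤ S.card := by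
  rw [colorDegree, ← Set.ncard_coe_finset]
  refine Set.ncard_le_ncard ?_ S.finite_toSet
  rintro _ ⟨u, hu, rfl⟩
  exact hS u hu

/-- Let `G` be a connected star-colored graph and `T` a rainbow tree in `G`
spanning a proper subset of the vertices.  If there are pairwise distinct
colors `c_1, …, c_r`, each appearing on an edge of `T`, such that every edge of
`G` with exactly one endpoint in `V(T)` has its color among them, and deleting
from `G[V(T)]` all edges with color among them leaves exactly `r + 1` connected
components, then `|V(T)| ≥ 2δᶜ(G)`. -/
theorem order_ge_two_min_color_degree {V C : Type*} [Fintype V]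
    (G : SimpleGraph V) (c : Sym2 V → C) (hG : G.Connected)
    (hstar : ∀ col : C, ∃ x : V, ∀ e ∈ G.edgeSet, c e = col → x ∈ e)
    (T : G.Subgraph) (hTtree : T.coe.IsTree) (hTrb : RainbowOn c T.edgeSet)
    (hTproper : T.verts ≠ Set.univ)
    (r : ℕ) (cs : Fin r → C) (hinj : Function.Injective cs)
    (hused : ∀ i, ∃ e ∈ T.edgeSet, c e = cs i)
    (hbd : ∀ x y : V, G.Adj x y → x ∈ T.verts → y ∉ T.verts → ∃ i, c s(x, y) = cs i)
    (hcomp : Nat.card (residualGraph G c T.verts (Set.range cs)).ConnectedComponent = r + 1) :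
    2 * minColorDegree G c ≤ T.verts.ncard := by
  classical
  choose ctr hctr using fun i => hstar (cs i)
  have hctrT : ∀ i, ctr i ∈ T.verts := by
    intro i
    obtain ⟨e, he, hc⟩ := hused i
    exact T.mem_verts_of_mem_edge he (hctr i e (T.edgeSet_subset he) hc)
  have hctr' : ∀ i a b, G.Adj a b → c s(a, b) = cs i → ctr i = a ∨ ctr i = b := by
    intro i a b hab hc
    simpa using hctr i s(a, b) hab hc
  have hKpos : 0 < Nat.card (residualGraph G c T.verts (Set.range cs)).ConnectedComponent := by
    omega
  obtain ⟨k₀⟩ := (Nat.card_pos_iff.1 hKpos).1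
  obtain ⟨v₀, -⟩ := k₀.exists_rep
  have hr : 0 < r := by
    obtain ⟨w, hw⟩ := (Set.ne_univ_iff_exists_notMem _).1 hTproper
    obtain ⟨p⟩ := hG.preconnected v₀.1 w
    obtain ⟨d, -, hd1, hd2⟩ := p.exists_boundary_dart T.verts v₀.2 hw
    obtain ⟨i, -⟩ := hbd _ _ d.adj hd1 hd2
    exact i.pos
  let x : Fin r → T.verts := fun i => ⟨ctr i, hctrT i⟩
  let comp := (residualGraph G c T.verts (Set.range cs)).connectedComponentMk
  let R : T.verts → T.verts → Prop := fun v w =>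
    G.Adj v w ∧ ∃ i, x i = w ∧ c s(v.1, w.1) = cs i
  have hR : ∀ v w, R v w → ¬ R w v := by
    rintro v w ⟨hvw, i, rfl, hi⟩ ⟨-, j, rfl, hj⟩
    rw [Sym2.eq_swap, hi] at hj
    exact hvw.ne (by rw [hinj hj])
  let := Fintype.ofFinite (residualGraph G c T.verts (Set.range cs)).ConnectedComponent
  rw [← Nat.card_coe_set_eq, Nat.card_eq_fintype_card]
  refine two_mul_le_card_of_asymmetric comp Quot.mk_surjective r hr
    (by rw [← Nat.card_eq_fintype_card, hcomp]) x R hR _ fun v => ?_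
  have hmin : minColorDegree G c ≤ colorDegree G c v := Nat.sInf_le ⟨v.1, rfl⟩
  set A : Finset T.verts := {w | comp w = comp v}
  set B : Finset (Fin r) := {i | x i = v}
  set D : Finset T.verts := {w ∈ Finset.univ.image x | comp w ≠ comp v ∧ R v w}
  let col : T.verts → C := fun w => c s(v.1, w.1)
  have hdeg := colorDegree_le_card G c v.1 ((A.erase v).image col ∪ B.image cs ∪ D.image col) ?_
  · have hvA : v ∈ A := by simp [A]
    have h1 := Finset.card_union_le ((A.erase v).image col ∪ B.image cs) (D.image col)
    have h2 := Finset.card_union_le ((A.erase v).image col) (B.image cs)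
    have h3 := Finset.card_image_le (s := A.erase v) (f := col)
    have h4 := Finset.card_image_le (s := B) (f := cs)
    have h5 := Finset.card_image_le (s := D) (f := col)
    have h6 := Finset.card_erase_add_one hvA
    omega
  · intro u hvu
    by_cases hu : u ∈ T.verts
    · by_cases hsame : comp ⟨u, hu⟩ = comp v
      · refine Finset.mem_union_left _ (Finset.mem_union_left _
          (Finset.mem_image.2 ⟨⟨u, hu⟩, ?_, rfl⟩))
        refine Finset.mem_erase.2 ⟨fun h => hvu.ne (by rw [← h]), by simp [A, hsame]⟩
      · obtain ⟨i, hi⟩ : ∃ i, cs i = c s(v.1, u) := by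
          by_contra hcol
          refine hsame (SimpleGraph.ConnectedComponent.sound ?_)
          refine SimpleGraph.Adj.reachable (SimpleGraph.Adj.symm ?_)
          rw [residualGraph, SimpleGraph.fromRel_adj]
          exact ⟨fun h => hvu.ne (by rw [h]), Or.inl ⟨hvu, hcol⟩⟩
        rcases hctr' i v u hvu hi.symm with h | h
        · exact Finset.mem_union_left _ (Finset.mem_union_right _
            (Finset.mem_image.2 ⟨i, by simp [B, x, h], hi⟩))
        · have hx : x i = ⟨u, hu⟩ := Subtype.ext h
          refine Finset.mem_union_right _ (Finset.mem_image.2 ⟨⟨u, hu⟩, ?_, rfl⟩)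
          exact Finset.mem_filter.2 ⟨Finset.mem_image.2 ⟨i, Finset.mem_univ i, hx⟩,
            hsame, hvu, i, hx, hi.symm⟩
    · obtain ⟨i, hi⟩ := hbd v u hvu v.2 hu
      have h : ctr i = v := (hctr' i v u hvu hi).resolve_right fun h => hu (h ▸ hctrT i)
      exact Finset.mem_union_left _ (Finset.mem_union_right _
        (Finset.mem_image.2 ⟨i, by simp [B, x, h], hi.symm⟩))
end

section
/- Let G be an edge-colored graph and let T be a rainbow tree in G. Let Ê = E(G[V(T)]) ∪ ∂(V(T)), let M_1 be the graphic matroid of the graph (V(G), Ê), and let M_2 be the partition matroid on Ê whose classes are the color classes of Ê, each with rank 1. If E(T) is a maximum-size common independent set of M_1 and M_2, then there exist r pairwise distinct colors c_1,…,c_r, each appearing on an edge of T, such that every edge of ∂(V(T)) has its color among c_1,…,c_r, and deleting from G[V(T)] all edges whose color lies in {c_1,…,c_r} leaves a graph with exactly r+1 connected components. -/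
/-- A set of edges is a forest (independent in the graphic matroid) if the
graph it spans is acyclic. -/
def IsForest {V : Type*} (E : Set (Sym2 V)) : Prop :=
  (SimpleGraph.fromEdgeSet E).IsAcyclic

/-- `Ê = E(G[V(T)]) ∪ ∂(V(T))`: the set of edges of `G` with at least one
endpoint in `X`. -/
def touchingEdges {V : Type*} (G : SimpleGraph V) (X : Set V) : Set (Sym2 V) :=
  {e ∈ G.edgeSet | ∃ x ∈ e, x ∈ X}

namespace SimpleGraph

variable {V W : Type*}

/-- A walk in the image of a graph that starts at the image of a vertex lifts to the graph. -/
theorem Reachable.exists_of_map {G : SimpleGraph V} (f : V ↪ W) {a : V} {v : W}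
    (h : (G.map f).Reachable (f a) v) : ∃ b, f b = v ∧ G.Reachable a b := by
  obtain ⟨p⟩ := h
  generalize hu : f a = u at p
  induction p generalizing a with
  | nil => exact ⟨a, hu, .rfl⟩
  | cons hadj _ ih =>
    obtain ⟨a', b', hab, ha, hb⟩ := (map_adj f G _ _).1 hadj
    obtain rfl : a' = a := f.injective (ha.trans hu.symm)
    obtain ⟨d, hd, hr⟩ := ih hb
    exact ⟨d, hd, hab.reachable.trans hr⟩

theorem IsAcyclic.map {G : SimpleGraph V} (hG : G.IsAcyclic) (f : V ↪ W) :
    (G.map f).IsAcyclic := by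
  rw [isAcyclic_iff_forall_adj_isBridge] at hG ⊢
  intro u v huv
  obtain ⟨a, b, hab, rfl, rfl⟩ := (map_adj f G _ _).1 huv
  have hbr := hG hab
  rw [isBridge_iff] at hbr ⊢
  intro hr
  have hle : (G.map f).deleteEdges {s(f a, f b)} ≤ (G.deleteEdges {s(a, b)}).map f := by
    intro u v h
    obtain ⟨h1, h2⟩ := deleteEdges_adj.1 h
    obtain ⟨a', b', hab', rfl, rfl⟩ := (map_adj f G _ _).1 h1
    refine (map_adj f _ _ _).2 ⟨a', b', deleteEdges_adj.2 ⟨hab', fun h3 => h2 ?_⟩, rfl, rfl⟩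
    have h4 : s(a', b') = s(a, b) := h3
    exact congrArg (Sym2.map f) h4
  obtain ⟨b', hb', hr'⟩ := (hr.mono hle).exists_of_map f
  rw [f.injective hb'] at hr'
  exact hbr hr'

/-- If adjacent vertices of `G` are reachable in `H`, then so are reachable vertices of `G`. -/
theorem Reachable.of_forall_adj {G H : SimpleGraph V} (h : ∀ u v, G.Adj u v → H.Reachable u v)
    {u v : V} (huv : G.Reachable u v) : H.Reachable u v := by
  obtain ⟨p⟩ := huv
  induction p with
  | nil => exact .rfl
  | cons hadj _ ih => exact (h _ _ hadj).trans ih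

theorem Reachable.of_sup_edge {G : SimpleGraph V} {a b u v : V}
    (h : (G ⊔ edge a b).Reachable u v) :
    G.Reachable u v ∨ (G.Reachable u a ∧ G.Reachable b v) ∨
      (G.Reachable u b ∧ G.Reachable a v) := by
  obtain ⟨p⟩ := h
  induction p with
  | nil => exact .inl .rfl
  | @cons u w v hadj _ ih =>
    rw [sup_adj, edge_adj] at hadj
    rcases hadj with hadj | ⟨⟨rfl, rfl⟩ | ⟨rfl, rfl⟩, -⟩
    · have hr := hadj.reachable
      rcases ih with h | ⟨h1, h2⟩ | ⟨h1, h2⟩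
      · exact .inl (hr.trans h)
      · exact .inr (.inl ⟨hr.trans h1, h2⟩)
      · exact .inr (.inr ⟨hr.trans h1, h2⟩)
    · rcases ih with h | ⟨h1, h2⟩ | ⟨h1, h2⟩
      · exact .inr (.inl ⟨.rfl, h⟩)
      · exact .inr (.inl ⟨.rfl, h2⟩)
      · exact .inl h2
    · rcases ih with h | ⟨h1, h2⟩ | ⟨h1, h2⟩
      · exact .inr (.inr ⟨.rfl, h⟩)
      · exact .inl h2
      · exact .inr (.inr ⟨.rfl, h2⟩)

/-- Joining two components by an edge lowers the number of components by one. -/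
theorem card_connectedComponent_sup_edge [Finite V] {G : SimpleGraph V} {a b : V}
    (hab : ¬ G.Reachable a b) :
    Nat.card G.ConnectedComponent = Nat.card (G ⊔ edge a b).ConnectedComponent + 1 := by
  classical
  have hne : a ≠ b := fun h => hab (h ▸ .rfl)
  have hle : G ≤ G ⊔ edge a b := le_sup_left
  have hjoin : (G ⊔ edge a b).Reachable a b :=
    Adj.reachable (sup_adj .. |>.2 (.inr ((edge_adj ..).2 ⟨.inl ⟨rfl, rfl⟩, hne⟩)))
  let φ : G.ConnectedComponent → Option (G ⊔ edge a b).ConnectedComponent := fun K =>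
    if K = G.connectedComponentMk b then none else some (K.map (Hom.ofLE hle))
  have hφ : Function.Bijective φ := by
    constructor
    · intro K L hKL
      induction K using ConnectedComponent.ind with | h u =>
      induction L using ConnectedComponent.ind with | h v =>
      simp only [φ] at hKL
      split_ifs at hKL with h1 h2 h2
      · exact h1.trans h2.symm
      · have h3 : (G ⊔ edge a b).Reachable u v :=
          ConnectedComponent.exact (Option.some.inj hKL)
        rw [ConnectedComponent.eq] at h1 h2 ⊢
        rcases h3.of_sup_edge with h | ⟨-, h⟩ | ⟨h, -⟩
        · exact h
        · exact absurd h.symm h2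
        · exact absurd h h1
    · rintro (_ | K)
      · exact ⟨G.connectedComponentMk b, if_pos rfl⟩
      · induction K using ConnectedComponent.ind with | h u =>
        by_cases hu : G.Reachable u b
        · refine ⟨G.connectedComponentMk a, ?_⟩
          have h1 : G.connectedComponentMk a ≠ G.connectedComponentMk b :=
            fun h => hab (ConnectedComponent.exact h)
          simp only [φ, if_neg h1, ConnectedComponent.map_mk]
          exact congrArg some (ConnectedComponent.sound (hjoin.trans (hu.mono hle).symm))
        · refine ⟨G.connectedComponentMk u, ?_⟩
          have h1 : G.connectedComponentMk u ≠ G.connectedComponentMk b :=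
            fun h => hu (ConnectedComponent.exact h)
          simp only [φ, if_neg h1, ConnectedComponent.map_mk]
          rfl
  rw [Nat.card_congr (Equiv.ofBijective φ hφ), Finite.card_option]

theorem deleteEdges_singleton_sup_edge {G : SimpleGraph V} {a b : V} (hab : G.Adj a b) :
    G.deleteEdges {s(a, b)} ⊔ edge a b = G := by
  have hne := hab.ne
  ext u v
  simp only [sup_adj, deleteEdges_adj, edge_adj, Set.mem_singleton_iff, Sym2.eq_iff]
  constructor
  · rintro (h | ⟨⟨rfl, rfl⟩ | ⟨rfl, rfl⟩, -⟩)
    exacts [h.1, hab, hab.symm]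
  · intro h
    have := h.ne
    tauto

/-- In a finite forest, edges and components together are as many as the vertices. -/
theorem IsAcyclic.ncard_edgeSet_add_card_connectedComponent [Finite V] {G : SimpleGraph V}
    (hG : G.IsAcyclic) : G.edgeSet.ncard + Nat.card G.ConnectedComponent = Nat.card V := by
  induction hn : G.edgeSet.ncard generalizing G with
  | zero =>
    have hbot : G = ⊥ := by
      rwa [Set.ncard_eq_zero, edgeSet_eq_empty] at hn
    subst hbot
    rw [zero_add]
    refine (Nat.card_congr (Equiv.ofBijective (connectedComponentMk ⊥) ⟨fun u v h => ?_, ?_⟩)).symm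
    · exact reachable_bot.1 (ConnectedComponent.exact h)
    · exact Quot.mk_surjective
  | succ n ih =>
    obtain ⟨e, he⟩ : G.edgeSet.Nonempty := by
      rw [← Set.ncard_pos]; omega
    induction e using Sym2.ind with | _ a b =>
    have hbr := isAcyclic_iff_forall_isBridge.1 hG he
    rw [isBridge_iff] at hbr
    have h1 := card_connectedComponent_sup_edge hbr
    rw [deleteEdges_singleton_sup_edge he] at h1
    have h2 : (G.deleteEdges {s(a, b)}).edgeSet.ncard = n := by
      rw [edgeSet_deleteEdges, Set.ncard_sdiff_singleton_of_mem he, hn]; rfl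
    have h3 := ih (hG.anti (deleteEdges_le _)) h2
    omega

/-- In a tree, vertices not separated by any single edge of `R` are not separated by `R`. -/
theorem IsTree.exists_not_reachable_deleteEdges {T : SimpleGraph V} (hT : T.IsTree)
    {R : Set (Sym2 V)} {a b : V} (h : ¬ (T.deleteEdges R).Reachable a b) :
    ∃ e ∈ R, e ∈ T.edgeSet ∧ ¬ (T.deleteEdges {e}).Reachable a b := by
  classical
  obtain ⟨p, hp⟩ := hT.connected.exists_isPath a b
  by_contra! hcon
  refine h ⟨p.toDeleteEdges R fun e he heR => ?_⟩
  obtain ⟨q, hq⟩ := (hcon e heR (p.edges_subset_edgeSet he)).exists_isPath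
  have hle := T.deleteEdges_le {e}
  have hpq : q.mapLe hle = p := (hT.existsUnique_path a b).unique (hq.mapLe hle) hp
  rw [← hpq, Walk.edges_mapLe_eq_edges] at he
  have := q.edges_subset_edgeSet he
  rw [edgeSet_deleteEdges] at this
  exact this.2 rfl

end SimpleGraph

open SimpleGraph

section Exchange

variable {W C : Type*}

/-- The colors at the end of a walk of length `n` from `S₀` in the exchange graph of `T`: a color is
one step away from the color of `y ∈ T` if it occurs on an edge of `H` whose endpoints
`T - y` separates. -/
def exchangeColors (H : SimpleGraph W) (c : Sym2 W → C) (S₀ : Set C) (T : SimpleGraph W) :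
    ℕ → Set C
  | 0 => S₀
  | n + 1 => {γ | ∃ a b, H.Adj a b ∧ c s(a, b) = γ ∧ ∃ y ∈ T.edgeSet,
      c y ∈ exchangeColors H c S₀ T n ∧ ¬ (T.deleteEdges {y}).Reachable a b}

/-- If no rainbow forest of size `m` misses a color of `S₀`, then no rainbow forest of size
`m` misses a color reachable from `S₀` in its exchange graph. -/
theorem exchangeColors_subset [Finite W] (H : SimpleGraph W) (c : Sym2 W → C) (S₀ : Set C) (m : ℕ)
    (hS₀ : ∀ T ≤ H, T.IsAcyclic → RainbowOn c T.edgeSet → T.edgeSet.ncard = m →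
      S₀ ⊆ c '' T.edgeSet) (k : ℕ) :
    ∀ T ≤ H, T.IsAcyclic → RainbowOn c T.edgeSet → T.edgeSet.ncard = m →
      exchangeColors H c S₀ T k ⊆ c '' T.edgeSet := by
  induction k using Nat.strong_induction_on with | _ k ih =>
  intro T hTH hT hrb hm
  cases k with
  | zero => exact hS₀ T hTH hT hrb hm
  | succ k =>
  rintro γ ⟨a, b, hab, rfl, y, hy, hyk, hsep⟩
  by_contra hγ
  have hinT : ∀ e ∈ T.edgeSet, c e ≠ c s(a, b) := fun e he h => hγ ⟨e, he, h⟩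
  set T' := T.deleteEdges {y} ⊔ edge a b with hT'
  have hedges : T'.edgeSet = insert s(a, b) (T.edgeSet \ {y}) := by
    rw [hT', edgeSet_sup, edgeSet_deleteEdges, edgeSet_edge_of_ne hab.ne, Set.union_comm]
    rfl
  have hT'H : T' ≤ H := sup_le ((T.deleteEdges_le _).trans hTH) (by
    rw [edge_le_iff]; exact .inr hab)
  have hT'ac : T'.IsAcyclic := (hT.anti (T.deleteEdges_le _)).sup_edge_of_not_reachable hsep
  have hT'rb : RainbowOn c T'.edgeSet := by
    rw [hedges]
    rintro e (rfl | he) f (rfl | hf) hef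
    · rfl
    · exact absurd hef.symm (hinT f hf.1)
    · exact absurd hef (hinT e he.1)
    · exact hrb e he.1 f hf.1 hef
  have hT'm : T'.edgeSet.ncard = m := by
    rw [hedges, Set.ncard_insert_of_notMem fun h => hinT _ h.1 rfl,
      Set.ncard_sdiff_singleton_add_one hy, hm]
  have hmono : ∀ j ≤ k, exchangeColors H c S₀ T j ⊆ exchangeColors H c S₀ T' j := by
    intro j
    induction j with
    | zero => exact fun _ => subset_rfl
    | succ j ihj =>
      rintro hj _ ⟨u, v, huv, rfl, z, hz, hzj, hzsep⟩
      have hzab : (T.deleteEdges {z}).Reachable a b := by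
        by_contra hcon
        exact hγ (ih (j + 1) (by omega) T hTH hT hrb hm ⟨a, b, hab, rfl, z, hz, hzj, hcon⟩)
      have hzy : z ≠ y := fun h => hsep (h ▸ hzab)
      refine ⟨u, v, huv, rfl, z, ?_, ihj (by omega) hzj, fun hr => hzsep (hr.of_forall_adj ?_)⟩
      · rw [hedges]; exact .inr ⟨hz, hzy⟩
      · intro p q hpq
        rw [deleteEdges_adj, hT', sup_adj, deleteEdges_adj, edge_adj] at hpq
        rcases hpq with ⟨hpq | ⟨⟨rfl, rfl⟩ | ⟨rfl, rfl⟩, -⟩, hpz⟩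
        · exact (deleteEdges_adj.2 ⟨hpq.1, hpz⟩).reachable
        · exact hzab
        · exact hzab.symm
  obtain ⟨e, he, hey⟩ := ih k (Nat.lt_succ_self k) T' hT'H hT'ac hT'rb hT'm (hmono k le_rfl hyk)
  rw [hedges] at he
  rcases he with rfl | he
  · exact hinT y hy hey.symm
  · exact he.2 (hrb e he.1 y hy hey)

end Exchange

/-- A rainbow forest of `G[X]` of maximum size among the rainbow forests of edges touching `X`
uses all colors of edges leaving `X`. -/
theorem mem_image_of_boundary_adj {V C : Type*} [Finite V] {G : SimpleGraph V} {c : Sym2 V → C}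
    {X : Set V} {m : ℕ}
    (hmax : ∀ F : Set (Sym2 V), F ⊆ touchingEdges G X → IsForest F → RainbowOn c F → F.ncard ≤ m)
    {T : SimpleGraph X} (hTG : T ≤ G.induce X) (hT : T.IsAcyclic)
    (hrb : RainbowOn (c ∘ Sym2.map (↑)) T.edgeSet) (hm : T.edgeSet.ncard = m)
    {x y : V} (hxy : G.Adj x y) (hx : x ∈ X) (hy : y ∉ X) :
    c s(x, y) ∈ (c ∘ Sym2.map (↑)) '' T.edgeSet := by
  by_contra hcon
  have hinT : ∀ e ∈ T.edgeSet, c (e.map (↑)) ≠ c s(x, y) := fun e he h => hcon ⟨e, he, h⟩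
  let f : X ↪ V := Function.Embedding.subtype _
  have hF : fromEdgeSet (insert s(x, y) (Sym2.map (↑) '' T.edgeSet)) = T.map f ⊔ edge x y := by
    rw [Set.insert_eq, Set.union_comm, fromEdgeSet_union, edge]
    congr 1
    rw [← fromEdgeSet_edgeSet (T.map f), edgeSet_map]
    rfl
  have hcard := hmax (insert s(x, y) (Sym2.map (↑) '' T.edgeSet)) ?_ ?_ ?_
  · rw [Set.ncard_insert_of_notMem, Set.ncard_image_of_injective _
      (Sym2.map.injective Subtype.val_injective)] at hcard
    · omega
    · rintro ⟨e, he, hexy⟩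
      exact hinT e he (congrArg c hexy)
  · rintro _ (rfl | ⟨e, he, rfl⟩)
    · exact ⟨hxy, x, Sym2.mem_mk_left _ _, hx⟩
    · induction e using Sym2.ind with | _ a b =>
      exact ⟨hTG he, a, Sym2.mem_mk_left _ _, a.2⟩
  · rw [IsForest, hF]
    refine (hT.map f).sup_edge_of_not_reachable fun hr => hy ?_
    obtain ⟨b, rfl, -⟩ := Reachable.exists_of_map f (a := ⟨x, hx⟩) hr
    exact b.2
  · rintro _ (rfl | ⟨e, he, rfl⟩) _ (rfl | ⟨e', he', rfl⟩) h
    · rfl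
    · exact absurd h.symm (hinT e' he')
    · exact absurd h (hinT e he)
    · exact congrArg _ (hrb e he e' he' h)

/-- Let `T` be a rainbow tree in an edge-colored graph `G`, and let
`Ê = E(G[V(T)]) ∪ ∂(V(T))`.  If `E(T)` is a maximum-size common independent
set of the graphic matroid of `(V(G), Ê)` (whose independent sets are the
forests `F ⊆ Ê`) and the partition matroid on `Ê` whose classes are the color
classes, each with rank `1` (whose independent sets are the rainbow sets
`F ⊆ Ê`), then there are pairwise distinct colors `c_1, …, c_r`, each appearing
on an edge of `T`, such that every edge of `∂(V(T))` has its color among them,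
and deleting from `G[V(T)]` all edges with color among them leaves exactly
`r + 1` connected components. -/
theorem reachable_colors_structure {V C : Type*} [Fintype V]
    (G : SimpleGraph V) (c : Sym2 V → C)
    (T : G.Subgraph) (hTtree : T.coe.IsTree) (hTrb : RainbowOn c T.edgeSet)
    (hmax : ∀ F : Set (Sym2 V), F ⊆ touchingEdges G T.verts →
      IsForest F → RainbowOn c F → F.ncard ≤ T.edgeSet.ncard) :
    ∃ (r : ℕ) (cs : Fin r → C), Function.Injective cs ∧
      (∀ i, ∃ e ∈ T.edgeSet, c e = cs i) ∧
      (∀ x y : V, G.Adj x y → x ∈ T.verts → y ∉ T.verts → ∃ i, c s(x, y) = cs i) ∧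
      Nat.card (residualGraph G c T.verts (Set.range cs)).ConnectedComponent = r + 1 := by
  classical
  set X := T.verts with hX
  set H : SimpleGraph X := G.induce X with hH
  let col : Sym2 X → C := c ∘ Sym2.map (↑)
  let S₀ : Set C := {γ | ∃ x y, G.Adj x y ∧ x ∈ X ∧ y ∉ X ∧ c s(x, y) = γ}
  have hedge : T.edgeSet = Sym2.map (↑) '' T.coe.edgeSet := T.image_coe_edgeSet_coe.symm
  have hinj : Function.Injective (Sym2.map ((↑) : X → V)) :=
    Sym2.map.injective Subtype.val_injective
  have hcard : T.coe.edgeSet.ncard = T.edgeSet.ncard := by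
    rw [hedge, Set.ncard_image_of_injective _ hinj]
  have hTH : T.coe ≤ H := fun a b h => T.adj_sub h
  have hrb : RainbowOn col T.coe.edgeSet := fun e he f hf hef =>
    hinj (hTrb _ (hedge ▸ ⟨e, he, rfl⟩) _ (hedge ▸ ⟨f, hf, rfl⟩) hef)
  let S : Set C := {γ | ∃ n, γ ∈ exchangeColors H col S₀ T.coe n}
  have hS : S ⊆ col '' T.coe.edgeSet := by
    rintro γ ⟨n, hn⟩
    refine exchangeColors_subset H col S₀ T.edgeSet.ncard ?_ n T.coe hTH hTtree.isAcyclic hrb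
      hcard hn
    rintro T' hT'H hT' hrb' hm' _ ⟨x, y, hxy, hx, hy, rfl⟩
    exact mem_image_of_boundary_adj hmax hT'H hT' hrb' hm' hxy hx hy
  let R : Set (Sym2 X) := {e ∈ T.coe.edgeSet | col e ∈ S}
  have hRS : col '' R = S := by
    refine Set.Subset.antisymm (by rintro _ ⟨e, he, rfl⟩; exact he.2) fun γ hγ => ?_
    obtain ⟨e, he, rfl⟩ := hS hγ
    exact ⟨e, ⟨he, hγ⟩, rfl⟩
  have hSfin : S.Finite := hRS ▸ (Set.toFinite R).image col
  have hRcard : R.ncard = S.ncard := by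
    rw [← hRS, Set.InjOn.ncard_image fun e he f hf h => hrb e he.1 f hf.1 h]
  have := hSfin.to_subtype
  let φ : Fin S.ncard ≃ S := (Finite.equivFinOfCardEq (Nat.card_coe_set_eq S)).symm
  have hrange : Set.range (fun i => (φ i : C)) = S := by
    rw [← Function.comp_def, Set.range_comp, φ.surjective.range_eq]
    simp
  refine ⟨S.ncard, fun i => φ i, Subtype.val_injective.comp φ.injective, fun i => ?_, ?_, ?_⟩
  · obtain ⟨e, he, h⟩ := hS (φ i).2
    exact ⟨_, hedge ▸ ⟨e, he, rfl⟩, h⟩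
  · intro x y hxy hx hy
    have : c s(x, y) ∈ S := ⟨0, x, y, hxy, hx, hy, rfl⟩
    exact ⟨φ.symm ⟨_, this⟩, by simp⟩
  · rw [hrange]
    have hle : T.coe.deleteEdges R ≤ residualGraph G c X S := by
      intro a b h
      obtain ⟨h1, h2⟩ := deleteEdges_adj.1 h
      exact (fromRel_adj ..).2 ⟨h1.ne, .inl ⟨hTH h1, fun h3 => h2 ⟨h1, h3⟩⟩⟩
    have hadj : ∀ a b : X, G.Adj a b → c s(a.1, b.1) ∉ S →
        (T.coe.deleteEdges R).Reachable a b := by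
      intro a b hab hc
      by_contra hcon
      obtain ⟨e, ⟨he, n, hn⟩, -, hsep⟩ := hTtree.exists_not_reachable_deleteEdges hcon
      exact hc ⟨n + 1, a, b, hab, rfl, e, he, hn, hsep⟩
    have hres : ∀ a b : X, (residualGraph G c X S).Adj a b →
        (T.coe.deleteEdges R).Reachable a b := by
      intro a b h
      rcases ((fromRel_adj ..).1 h).2 with h | h
      · exact hadj a b h.1 h.2
      · exact (hadj b a h.1 h.2).symm
    have hcc : Nat.card (residualGraph G c X S).ConnectedComponent =
        Nat.card (T.coe.deleteEdges R).ConnectedComponent := by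
      refine (Nat.card_congr (Equiv.ofBijective _
        ⟨?_, ConnectedComponent.surjective_map_ofLE hle⟩)).symm
      intro K L hKL
      induction K using ConnectedComponent.ind with | h u =>
      induction L using ConnectedComponent.ind with | h v =>
      exact ConnectedComponent.sound ((ConnectedComponent.exact hKL).of_forall_adj hres)
    have h1 := (hTtree.isAcyclic.anti
      (T.coe.deleteEdges_le R)).ncard_edgeSet_add_card_connectedComponent
    have h2 := (isTree_iff_connected_and_card.1 hTtree).2
    rw [edgeSet_deleteEdges] at h1
    have h3 := Set.ncard_sdiff_add_ncard_of_subset (s := R) (t := T.coe.edgeSet) fun e he => he.1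
    rw [Nat.card_coe_set_eq] at h2
    omega
end

section
/- Let G be an edge-colored connected graph and let T be a rainbow tree in G whose vertex set V(T) is a proper subset of V(G). Let Ê = E(G[V(T)]) ∪ ∂(V(T)), let M_1 be the graphic matroid of the graph (V(G), Ê), and let M_2 be the partition matroid on Ê whose classes are the color classes of Ê, each with rank 1. If E(T) is a maximum-size common independent set of M_1 and M_2, then G has no rainbow spanning tree. -/
/-- In a connected graph, at least `|X|` edges have an endpoint in a proper vertex subset `X`:
each vertex of `X` has its own edge towards a fixed vertex outside `X`. -/
lemma SimpleGraph.Connected.ncard_le_ncard_touchingEdges {V : Type*} [Finite V]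
    {H : SimpleGraph V} (hH : H.Connected) {X : Set V} (hX : X ≠ Set.univ) :
    X.ncard ≤ (touchingEdges H X).ncard := by
  obtain ⟨r, hr⟩ := (Set.ne_univ_iff_exists_notMem X).1 hX
  have parent : ∀ x ∈ X, ∃ y, H.Adj x y ∧ H.dist y r < H.dist x r := by
    intro x hx
    obtain ⟨p, hp⟩ := hH.exists_walk_length_eq_dist x r
    cases p with
    | nil => exact absurd hx hr
    | @cons _ y _ h q =>
      refine ⟨y, h, ?_⟩
      rw [← hp, SimpleGraph.Walk.length_cons]
      exact Nat.lt_succ_of_le (SimpleGraph.dist_le q)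
  choose! f hadj hlt using parent
  refine Set.ncard_le_ncard_of_injOn (fun x ↦ s(x, f x))
    (fun x hx ↦ ⟨hadj x hx, x, Sym2.mem_mk_left _ _, hx⟩) ?_ (Set.toFinite _)
  intro a ha b hb hab
  rcases Sym2.eq_iff.1 hab with ⟨h, -⟩ | ⟨h, h'⟩
  · exact h
  · have ha' := hlt a ha
    have hb' := hlt b hb
    rw [h'] at ha'
    rw [← h] at hb'
    exact absurd ha' hb'.not_gt

/-- A finite tree subgraph has one edge fewer than it has vertices. -/
lemma SimpleGraph.Subgraph.ncard_edgeSet_add_one_of_isTree {V : Type*} [Finite V]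
    {G : SimpleGraph V} {T : G.Subgraph} (hT : T.coe.IsTree) :
    T.edgeSet.ncard + 1 = T.verts.ncard := by
  rw [← T.image_coe_edgeSet_coe,
    Set.ncard_image_of_injective _ (Sym2.map.injective Subtype.val_injective)]
  exact (isTree_iff_connected_and_card.1 hT).2

/-- Let `G` be an edge-colored connected graph and `T` a rainbow tree in `G`
spanning a proper subset of the vertices, and let
`Ê = E(G[V(T)]) ∪ ∂(V(T))`.  If `E(T)` is a maximum-size common independent
set of the graphic matroid of `(V(G), Ê)` (whose independent sets are the
forests `F ⊆ Ê`) and the partition matroid on `Ê` whose classes are the color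
classes, each with rank `1` (whose independent sets are the rainbow sets
`F ⊆ Ê`), then `G` has no rainbow spanning tree. -/
theorem no_rainbow_spanning_tree_of_max_common_independent {V C : Type*} [Fintype V]
    (G : SimpleGraph V) (c : Sym2 V → C) (hG : G.Connected)
    (T : G.Subgraph) (hTtree : T.coe.IsTree) (hTrb : RainbowOn c T.edgeSet)
    (hTproper : T.verts ≠ Set.univ)
    (hmax : ∀ F : Set (Sym2 V), F ⊆ touchingEdges G T.verts →
      IsForest F → RainbowOn c F → F.ncard ≤ T.edgeSet.ncard) :
    ¬ ∃ T' : G.Subgraph, T'.verts = Set.univ ∧ T'.coe.IsTree ∧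
        RainbowOn c T'.edgeSet := by
  rintro ⟨T', hspan, htree, hrb⟩
  have hiso := T'.spanningCoeEquivCoeOfSpanning (SimpleGraph.Subgraph.isSpanning_iff.2 hspan)
  have htree' : T'.spanningCoe.IsTree := hiso.isTree_iff.2 htree
  have hsub : touchingEdges T'.spanningCoe T.verts ⊆ T'.edgeSet :=
    fun e he ↦ T'.edgeSet_spanningCoe ▸ he.1
  have hcard := hmax (touchingEdges T'.spanningCoe T.verts)
    (fun e he ↦ ⟨T'.edgeSet_subset (hsub he), he.2⟩)
    (htree'.isAcyclic.anti <| (SimpleGraph.fromEdgeSet_mono fun _ he ↦ he.1).trans_eq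
      (SimpleGraph.fromEdgeSet_edgeSet T'.spanningCoe))
    (fun e he f hf ↦ hrb e (hsub he) f (hsub hf))
  have hlower := htree'.connected.ncard_le_ncard_touchingEdges hTproper
  have hT := SimpleGraph.Subgraph.ncard_edgeSet_add_one_of_isTree hTtree
  omega
end
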